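/- Let A →^φ B → C → D be an exact sequence of finitely generated ℤ-modules (exact at B and at C). Let φ_free : A_free → B_free be the map induced by φ on the free quotients, and let Q be the cokernel of φ_free. Then the torsion subgroups B_tors, C_tors, D_tors and Q_tors are finite, and |C_tors| ≤ |Q_tors| · |B_tors| · |D_tors|. -/

import Mathlib

/-- Any `ℤ`-linear map sends torsion elements to torsion elements. -/
theorem torsion_le_comap {A B : Type} [AddCommGroup A] [AddCommGroup B] (φ : A →ₗ[ℤ] B) :
    Submodule.torsion ℤ A ≤ (Submodule.torsion ℤ B).comap φ := by
  rintro x ⟨n, hn⟩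
  refine ⟨n, ?_⟩
  rw [Submonoid.smul_def] at hn ⊢
  rw [← map_smul, hn, map_zero]

/-- The free part `M_free = M / M_tors` of a `ℤ`-module `M`. -/
abbrev freePart (M : Type) [AddCommGroup M] : Type := M ⧸ Submodule.torsion ℤ M

/-- The map `φ_free : A_free → B_free` induced on free parts by a `ℤ`-linear map `φ : A → B`. -/
noncomputable def freePartMap {A B : Type} [AddCommGroup A] [AddCommGroup B] (φ : A →ₗ[ℤ] B) :
    freePart A →ₗ[ℤ] freePart B :=
  Submodule.mapQ _ _ φ (torsion_le_comap φ)

/-- If every torsion element of `ker g` is the image under `f` of a torsion element, then the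
torsion of `N` is bounded by that of `P` and `M`. -/
theorem card_torsion_le_mul {M N P : Type} [AddCommGroup M] [AddCommGroup N] [AddCommGroup P]
    [Finite (Submodule.torsion ℤ M)] [Finite (Submodule.torsion ℤ P)]
    (f : M →ₗ[ℤ] N) (g : N →ₗ[ℤ] P)
    (h : LinearMap.ker g ⊓ Submodule.torsion ℤ N ≤ (Submodule.torsion ℤ M).map f) :
    Nat.card (Submodule.torsion ℤ N) ≤
      Nat.card (Submodule.torsion ℤ P) * Nat.card (Submodule.torsion ℤ M) := by
  let t : Submodule.torsion ℤ N →ₗ[ℤ] Submodule.torsion ℤ P := g.restrict (torsion_le_comap g)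
  have hker : Nat.card (LinearMap.ker t) ≤ Nat.card (Submodule.torsion ℤ M) := by
    have lift (x : LinearMap.ker t) : ∃ m : Submodule.torsion ℤ M, f m = x.1.1 := by
      obtain ⟨m, hm, hmx⟩ := h ⟨congrArg Subtype.val x.2, x.1.2⟩
      exact ⟨⟨m, hm⟩, hmx⟩
    choose s hs using lift
    refine Nat.card_le_card_of_injective s fun x y hxy => ?_
    exact Subtype.ext (Subtype.ext (by rw [← hs x, ← hs y, hxy]))
  have hquot : Nat.card (Submodule.torsion ℤ N ⧸ LinearMap.ker t) ≤
      Nat.card (Submodule.torsion ℤ P) := by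
    rw [Nat.card_congr t.quotKerEquivRange.toEquiv]
    exact Nat.card_le_card_of_injective _ Subtype.val_injective
  rw [Submodule.card_eq_card_quotient_mul_card (LinearMap.ker t)]
  exact (mul_comm _ _).trans_le (Nat.mul_le_mul hquot hker)

/-- The torsion submodule of a finitely generated `ℤ`-module is finite. -/
theorem finite_torsion_int (M : Type) [AddCommGroup M] [Module.Finite ℤ M] :
    Finite (Submodule.torsion ℤ M) :=
  Module.finite_of_fg_torsion _ Submodule.torsion_isTorsion

/-- The torsion of the cokernel of `φ` is controlled by that of the cokernel of `φ_free` and the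
torsion of the target. -/
theorem card_torsion_coker_le {A B : Type} [AddCommGroup A] [AddCommGroup B] [Module.Finite ℤ B]
    (φ : A →ₗ[ℤ] B) :
    Nat.card (Submodule.torsion ℤ (B ⧸ LinearMap.range φ)) ≤
      Nat.card (Submodule.torsion ℤ (freePart B ⧸ LinearMap.range (freePartMap φ))) *
        Nat.card (Submodule.torsion ℤ B) := by
  have := finite_torsion_int B
  have := finite_torsion_int (freePart B ⧸ LinearMap.range (freePartMap φ))
  have hle : LinearMap.range φ ≤
      (LinearMap.range (freePartMap φ)).comap (Submodule.torsion ℤ B).mkQ := by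
    rintro _ ⟨a, rfl⟩
    exact ⟨Submodule.Quotient.mk a, rfl⟩
  refine card_torsion_le_mul (LinearMap.range φ).mkQ (Submodule.mapQ _ _ _ hle) ?_
  rintro x ⟨hx, -⟩
  obtain ⟨b, rfl⟩ := Submodule.Quotient.mk_surjective _ x
  obtain ⟨a', ha⟩ := (Submodule.Quotient.mk_eq_zero _).1 hx
  obtain ⟨a, rfl⟩ := Submodule.Quotient.mk_surjective _ a'
  refine ⟨b - φ a, (Submodule.Quotient.eq _).1 ha.symm, (Submodule.Quotient.eq _).2 ?_⟩
  exact ⟨-a, by simp⟩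

/-- Let `A →^φ B →^ψ C →^χ D` be a sequence of finitely generated `ℤ`-modules, exact at `B`
and at `C`.  Let `Q` be the cokernel of the induced map `φ_free : A_free → B_free`.  Then the
torsion subgroups `B_tors`, `C_tors`, `D_tors`, `Q_tors` are all finite, and
`|C_tors| ≤ |Q_tors| ⬝ |B_tors| ⬝ |D_tors|`. -/
theorem torsion_bound_of_exact (A B C D : Type)
    [AddCommGroup A] [AddCommGroup B] [AddCommGroup C] [AddCommGroup D]
    [Module.Finite ℤ A] [Module.Finite ℤ B] [Module.Finite ℤ C] [Module.Finite ℤ D]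
    (φ : A →ₗ[ℤ] B) (ψ : B →ₗ[ℤ] C) (χ : C →ₗ[ℤ] D)
    (hB : Function.Exact φ ψ) (hC : Function.Exact ψ χ) :
    Finite (Submodule.torsion ℤ B) ∧ Finite (Submodule.torsion ℤ C) ∧
      Finite (Submodule.torsion ℤ D) ∧
      Finite (Submodule.torsion ℤ (freePart B ⧸ LinearMap.range (freePartMap φ))) ∧
      Nat.card (Submodule.torsion ℤ C) ≤
        Nat.card (Submodule.torsion ℤ (freePart B ⧸ LinearMap.range (freePartMap φ))) *
          Nat.card (Submodule.torsion ℤ B) * Nat.card (Submodule.torsion ℤ D) := by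
  have := finite_torsion_int (B ⧸ LinearMap.range φ)
  have := finite_torsion_int D
  refine ⟨finite_torsion_int B, finite_torsion_int C, finite_torsion_int D,
    finite_torsion_int _, ?_⟩
  have hexact := LinearMap.exact_iff.1 hB
  let f : (B ⧸ LinearMap.range φ) →ₗ[ℤ] C := (LinearMap.range φ).liftQ ψ hexact.ge
  have hf : Function.Injective f :=
    LinearMap.ker_eq_bot.1 (Submodule.ker_liftQ_eq_bot _ _ _ hexact.le)
  have hC' : Nat.card (Submodule.torsion ℤ C) ≤ Nat.card (Submodule.torsion ℤ D) *
      Nat.card (Submodule.torsion ℤ (B ⧸ LinearMap.range φ)) := by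
    refine card_torsion_le_mul f χ ?_
    rintro c ⟨hc, n, hn⟩
    obtain ⟨b, rfl⟩ := (hC c).1 hc
    refine ⟨Submodule.Quotient.mk b, ⟨n, hf ?_⟩, rfl⟩
    rw [Submonoid.smul_def] at hn ⊢
    rw [map_smul, map_zero]
    exact hn
  calc
    _ ≤ _ := hC'
    _ = _ := mul_comm _ _
    _ ≤ _ := Nat.mul_le_mul_right _ (card_torsion_coker_le φ)
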